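/- There exists N such that for every integer n ≥ N with n ≡ 4 (mod 7), the number of isomorphism classes of cyclic (K_{10n+1}, C_5)-designs satisfies NC(10n+1, 5) ≥ 38.4^n. -/

import Mathlib

namespace CCS

/-- A block: a set of edges of the complete graph on `ZMod v`. -/
abbrev Block (v : ℕ) := Finset (Sym2 (ZMod v))

/-- The edge set of the closed tuple `c = (c 0, c 1, …, c (k-1))`. -/
def edgesOf {v k : ℕ} (c : Fin k → ZMod v) : Block v :=
  Finset.image (fun i : Fin k => s(c i, c ⟨(i.1 + 1) % k, Nat.mod_lt _ i.pos⟩)) Finset.univ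

/-- `E` is the edge set of a `k`-cycle on `ZMod v`. Since for `k ≥ 3` the edge set
determines the closed tuple up to rotation and reversal, a `k`-cycle is identified
with its edge set. -/
def IsCycleBlock (v k : ℕ) (E : Block v) : Prop :=
  ∃ c : Fin k → ZMod v, Function.Injective c ∧ E = edgesOf c

/-- The translate `E + z` of a cycle. -/
def translateBlock {v : ℕ} (E : Block v) (z : ZMod v) : Block v :=
  E.image (Sym2.map (· + z))

/-- A `(K_v, C_k)`-design: a set of `k`-cycles whose edge sets partition the edges of `K_v`. -/
def IsDesign (v k : ℕ) (B : Set (Block v)) : Prop :=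
  (∀ E ∈ B, IsCycleBlock v k E) ∧
  ∀ e : Sym2 (ZMod v), ¬ e.IsDiag → ∃! E, E ∈ B ∧ e ∈ E

/-- A cyclic `(K_v, C_k)`-design. -/
def IsCyclicDesign (v k : ℕ) (B : Set (Block v)) : Prop :=
  IsDesign v k B ∧ ∀ E ∈ B, ∀ z : ZMod v, translateBlock E z ∈ B

/-- Two designs are isomorphic if a bijection of `ZMod v` maps one onto the other. -/
def Isomorphic {v : ℕ} (B B' : Set (Block v)) : Prop :=
  ∃ f : ZMod v ≃ ZMod v, B' = (fun E : Block v => E.image (Sym2.map f)) '' B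

/-- `NC v k`: the number of cyclic `(K_v, C_k)`-designs up to isomorphism. -/
noncomputable def NC (v k : ℕ) : ℕ :=
  Nat.card (Quot fun B B' : {B : Set (Block v) // IsCyclicDesign v k B} =>
    Isomorphic B.1 B'.1)

/-- The type of a cycle: the order of its stabilizer under translations. -/
noncomputable def cycleType {v : ℕ} (E : Block v) : ℕ :=
  Nat.card {z : ZMod v // translateBlock E z = E}

/-- The two differences `±(a-b)` arising from an edge `{a,b}`. -/
def edgeDiffs {v : ℕ} : Sym2 (ZMod v) → Multiset (ZMod v) :=
  Sym2.lift ⟨fun a b => {a - b, b - a}, fun a b => by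
    show (a-b) ::ₘ {b-a} = (b-a) ::ₘ {a-b}; exact Multiset.cons_swap _ _ _⟩

/-- The multiset of the `2k` differences arising from the `k` edges of a cycle.
For a cycle of type `d` this is `d` copies of the list `∂C` of partial differences. -/
def fullDiffs {v : ℕ} (E : Block v) : Multiset (ZMod v) :=
  E.val.bind edgeDiffs

/-- The multiset `∂C` of partial differences of a cycle: each difference is counted
with multiplicity equal to its multiplicity among the `2k` edge differences divided
by the type of the cycle. -/
noncomputable def partialDiffs {v : ℕ} (E : Block v) : Multiset (ZMod v) :=
  (fullDiffs E).toFinset.val.bind fun x =>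
    Multiset.replicate ((fullDiffs E).count x / cycleType E) x

/-- A `(K_v, C_k)`-difference system: a set of `k`-cycles whose partial differences
cover every nonzero element of `ZMod v` exactly once. -/
def IsDifferenceSystem (v k : ℕ) (F : Finset (Block v)) : Prop :=
  (∀ E ∈ F, IsCycleBlock v k E) ∧
  ∀ x : ZMod v, (F.val.bind partialDiffs).count x = if x = 0 then 0 else 1

end CCS

namespace CCS

/-! ### Five-cycles and their edge sets -/

theorem mem_edgesOf {v : ℕ} {c : Fin 5 → ZMod v} {e : Sym2 (ZMod v)} :
    e ∈ edgesOf c ↔ ∃ i : Fin 5, e = s(c i, c (i + 1)) := by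
  have h : ∀ i : Fin 5, (⟨(i.1 + 1) % 5, Nat.mod_lt _ i.pos⟩ : Fin 5) = i + 1 := by decide
  simp only [edgesOf, Finset.mem_image, Finset.mem_univ, true_and, h]
  exact ⟨fun ⟨i, hi⟩ => ⟨i, hi.symm⟩, fun ⟨i, hi⟩ => ⟨i, hi.symm⟩⟩

theorem image_edgesOf {v : ℕ} (c : Fin 5 → ZMod v) (f : ZMod v → ZMod v) :
    (edgesOf c).image (Sym2.map f) = edgesOf (f ∘ c) := by
  ext e
  simp only [Finset.mem_image, mem_edgesOf]
  constructor
  · rintro ⟨_, ⟨i, rfl⟩, rfl⟩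
    exact ⟨i, by simp⟩
  · rintro ⟨i, rfl⟩
    exact ⟨_, ⟨i, rfl⟩, by simp⟩

theorem edgesOf_rotate {v : ℕ} (c : Fin 5 → ZMod v) (k : Fin 5) :
    edgesOf (fun j => c (j + k)) = edgesOf c := by
  ext e
  simp only [mem_edgesOf]
  constructor
  · rintro ⟨i, rfl⟩
    exact ⟨i + k, by rw [add_right_comm]⟩
  · rintro ⟨i, rfl⟩
    exact ⟨i - k, by rw [add_right_comm, sub_add_cancel]⟩

theorem edgesOf_reverse {v : ℕ} (c : Fin 5 → ZMod v) :
    edgesOf (fun j => c (-j)) = edgesOf c := by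
  ext e
  simp only [mem_edgesOf]
  constructor
  · rintro ⟨i, rfl⟩
    exact ⟨-(i + 1), by rw [Sym2.eq_swap, neg_add, neg_add_cancel_right]⟩
  · rintro ⟨i, rfl⟩
    exact ⟨-(i + 1), by
      rw [Sym2.eq_swap, neg_neg, show -(-(i + 1) + 1) = i by abel]⟩

/-- In a five-cycle the neighbours of `c i` are `c (i + 1)` and `c (i - 1)`. -/
theorem eq_or_eq_of_mem_edgesOf {v : ℕ} {c : Fin 5 → ZMod v} (hc : Function.Injective c)
    {i : Fin 5} {w : ZMod v} (h : s(c i, w) ∈ edgesOf c) : w = c (i + 1) ∨ w = c (i - 1) := by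
  obtain ⟨j, hj⟩ := mem_edgesOf.1 h
  rcases Sym2.eq_iff.1 hj with ⟨h1, h2⟩ | ⟨h1, h2⟩
  · left; rw [h2, hc h1]
  · right; rw [h2, hc h1, add_sub_cancel_right]

/-- `c` traverses a cycle of `B`. -/
def Traverses {v : ℕ} (B : Set (Block v)) (c : Fin 5 → ZMod v) : Prop :=
  Function.Injective c ∧ edgesOf c ∈ B

theorem Traverses.rotate {v : ℕ} {B : Set (Block v)} {c : Fin 5 → ZMod v} (h : Traverses B c)
    (k : Fin 5) : Traverses B (fun j => c (j + k)) :=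
  ⟨h.1.comp (add_left_injective k), by rw [edgesOf_rotate]; exact h.2⟩

theorem Traverses.reverse {v : ℕ} {B : Set (Block v)} {c : Fin 5 → ZMod v} (h : Traverses B c) :
    Traverses B (fun j => c (-j)) :=
  ⟨h.1.comp neg_injective, by rw [edgesOf_reverse]; exact h.2⟩

theorem IsDesign.exists_traverses {v : ℕ} {B : Set (Block v)} (hB : IsDesign v 5 B)
    {a x : ZMod v} (hax : a ≠ x) : ∃ c, Traverses B c ∧ c 0 = a ∧ c 1 = x := by
  obtain ⟨E, ⟨hE, he⟩, -⟩ := hB.2 s(a, x) (by simpa using hax)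
  obtain ⟨c, hc, rfl⟩ := hB.1 E hE
  have ht : Traverses B c := ⟨hc, hE⟩
  obtain ⟨i, hi⟩ := mem_edgesOf.1 he
  rcases Sym2.eq_iff.1 hi with ⟨h1, h2⟩ | ⟨h1, h2⟩
  · exact ⟨_, ht.rotate i, by simp [h1], by simp [h2, add_comm]⟩
  · exact ⟨_, (ht.rotate (i + 1)).reverse, by simp [h1], by simp [h2]⟩

/-- A traversal of a cycle of a design is determined by two consecutive vertices. -/
theorem Traverses.eq_of_eq {v : ℕ} {B : Set (Block v)} (hB : IsDesign v 5 B)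
    {c c' : Fin 5 → ZMod v} (h : Traverses B c) (h' : Traverses B c') {i : Fin 5}
    (h0 : c i = c' i) (h1 : c (i + 1) = c' (i + 1)) : c = c' := by
  have hne : c i ≠ c (i + 1) := fun hh => by simpa using h.1 hh
  have hE : edgesOf c = edgesOf c' :=
    (hB.2 s(c i, c (i + 1)) (by simpa using hne)).unique
      ⟨h.2, mem_edgesOf.2 ⟨i, rfl⟩⟩ ⟨h'.2, mem_edgesOf.2 ⟨i, by rw [h0, h1]⟩⟩
  have step : ∀ j : Fin 5, c j = c' j → c (j + 1) = c' (j + 1) →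
      c (j + 1 + 1) = c' (j + 1 + 1) := by
    intro j hj hj1
    have hm : s(c (j + 1), c' (j + 1 + 1)) ∈ edgesOf c := by
      rw [hE, hj1]; exact mem_edgesOf.2 ⟨_, rfl⟩
    rcases eq_or_eq_of_mem_edgesOf h.1 hm with hh | hh
    · exact hh.symm
    · rw [add_sub_cancel_right, hj] at hh
      have := h'.1 hh
      rw [add_assoc, add_eq_left] at this
      exact absurd this (by decide)
  have h2 := step _ h0 h1
  have h3 := step _ h1 h2
  have h4 := step _ h2 h3
  funext j
  have hj : j = i ∨ j = i + 1 ∨ j = i + 1 + 1 ∨ j = i + 1 + 1 + 1 ∨ j = i + 1 + 1 + 1 + 1 := by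
    have : ∀ i j : Fin 5, j = i ∨ j = i + 1 ∨ j = i + 1 + 1 ∨ j = i + 1 + 1 + 1 ∨
      j = i + 1 + 1 + 1 + 1 := by decide
    exact this i j
  rcases hj with rfl | rfl | rfl | rfl | rfl <;> assumption

/-! ### Subsystems and automorphisms -/

/-- `A` contains every cycle of `B` having an edge inside `A`. -/
def IsSubsystem {v : ℕ} (B : Set (Block v)) (A : Finset (ZMod v)) : Prop :=
  ∀ c, Traverses B c → c 0 ∈ A → c 1 ∈ A → ∀ j, c j ∈ A

theorem IsSubsystem.mem {v : ℕ} {B : Set (Block v)} {A : Finset (ZMod v)} (hA : IsSubsystem B A)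
    {c : Fin 5 → ZMod v} (hc : Traverses B c) (i : Fin 5) (h0 : c i ∈ A) (h1 : c (i + 1) ∈ A)
    (j : Fin 5) : c j ∈ A := by
  have := hA _ (hc.rotate i) (by simpa using h0) (by simpa [add_comm] using h1) (j - i)
  simpa using this

/-- A subsystem properly containing another one is at least one and a half times as large. -/
theorem IsSubsystem.card_le {v : ℕ} {B : Set (Block v)} (hB : IsDesign v 5 B)
    {A C : Finset (ZMod v)} (hA : IsSubsystem B A) (hC : IsSubsystem B C) (hAC : A ⊂ C) :
    3 * A.card ≤ 2 * C.card := by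
  classical
  have key : ∀ q : ZMod v × ZMod v, ∃ c : Fin 5 → ZMod v, q ∈ A ×ˢ (C \ A) →
      Traverses B c ∧ c 0 = q.1 ∧ c 1 = q.2 := by
    intro q
    by_cases hq : q ∈ A ×ˢ (C \ A)
    · simp only [Finset.mem_product, Finset.mem_sdiff] at hq
      obtain ⟨c, hc⟩ := hB.exists_traverses (a := q.1) (x := q.2)
        (fun h => hq.2.2 (h ▸ hq.1))
      exact ⟨c, fun _ => hc⟩
    · exact ⟨fun _ => 0, fun h => absurd h hq⟩
  choose c hc using key
  let φ : ZMod v × ZMod v → Bool × ZMod v × ZMod v := fun q =>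
    if c q 2 ∈ A then (true, c q 3, c q 4) else (false, c q 1, c q 2)
  have hcard : (A ×ˢ (C \ A)).card ≤
      ((Finset.univ : Finset Bool) ×ˢ ((C \ A) ×ˢ (C \ A))).card := by
    refine Finset.card_le_card_of_injOn φ ?_ ?_
    · intro q hq
      obtain ⟨ht, h0, h1⟩ := hc q hq
      simp only [Finset.coe_product, Set.mem_prod, Finset.mem_coe, Finset.mem_sdiff] at hq
      have hqC : ∀ j, c q j ∈ C := hC _ ht (h0 ▸ hAC.1 hq.1) (h1 ▸ hq.2.1)
      have hout : ∀ i, c q i ∈ A → c q (i + 1) ∉ A := fun i hi hi1 =>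
        hq.2.2 (h1 ▸ hA.mem ht i hi hi1 1)
      have hc1 : c q 1 ∉ A := h1 ▸ hq.2.2
      have hc4 : c q 4 ∉ A := fun h => hout 4 h (by
        have : (4 : Fin 5) + 1 = 0 := by decide
        rw [this, h0]; exact hq.1)
      by_cases h2 : c q 2 ∈ A
      · have hc3 : c q 3 ∉ A := hout 2 h2
        simp [φ, h2, hqC, hc3, hc4]
      · simp [φ, h2, hqC, hc1]
    · intro q hq q' hq' h
      obtain ⟨ht, h0, h1⟩ := hc q hq
      obtain ⟨ht', h0', h1'⟩ := hc q' hq'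
      have hcc : c q = c q' := by
        by_cases h2 : c q 2 ∈ A <;> by_cases h2' : c q' 2 ∈ A <;>
          simp only [φ, h2, h2', if_true, if_false, Prod.mk.injEq, true_and,
            reduceCtorEq, false_and] at h
        · exact ht.eq_of_eq hB ht' (i := 3) h.1 h.2
        · exact ht.eq_of_eq hB ht' (i := 1) h.1 h.2
      exact Prod.ext (by rw [← h0, ← h0', hcc]) (by rw [← h1, ← h1', hcc])
  have hpos : 0 < (C \ A).card := Finset.card_pos.2 (Finset.sdiff_nonempty.2 hAC.2)
  simp only [Finset.card_product, Finset.card_univ, Fintype.card_bool] at hcard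
  have h2 : A.card ≤ 2 * (C \ A).card := by
    refine Nat.le_of_mul_le_mul_right ?_ hpos
    rw [mul_assoc]; exact hcard
  have h3 := Finset.card_sdiff_add_card_eq_card hAC.1
  omega

/-- The image of a block under a permutation of the vertices. -/
def mapBlock {v : ℕ} (f : Equiv.Perm (ZMod v)) (E : Block v) : Block v :=
  E.image (Sym2.map f)

theorem mapBlock_one {v : ℕ} (E : Block v) : mapBlock 1 E = E := by
  simp [mapBlock, Equiv.Perm.coe_one]

theorem mapBlock_mul {v : ℕ} (f g : Equiv.Perm (ZMod v)) (E : Block v) :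
    mapBlock (f * g) E = mapBlock f (mapBlock g E) := by
  simp only [mapBlock, Equiv.Perm.coe_mul, Sym2.map_comp, Finset.image_image]

/-- The automorphisms of a set of blocks. -/
def automorphisms {v : ℕ} (B : Set (Block v)) : Subgroup (Equiv.Perm (ZMod v)) where
  carrier := {f | ∀ E, mapBlock f E ∈ B ↔ E ∈ B}
  one_mem' := fun E => by rw [mapBlock_one]
  mul_mem' := fun {f g} hf hg E => by rw [mapBlock_mul, hf, hg]
  inv_mem' := fun {f} hf E => by rw [← hf, ← mapBlock_mul, mul_inv_cancel, mapBlock_one]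

open Classical in
/-- The common fixed points of the automorphisms fixing `S` pointwise. -/
noncomputable def fixedHull {v : ℕ} [NeZero v] (B : Set (Block v)) (S : Finset (ZMod v)) :
    Finset (ZMod v) :=
  {y | ∀ f ∈ automorphisms B, (∀ s ∈ S, f s = s) → f y = y}

theorem mem_fixedHull {v : ℕ} [NeZero v] {B : Set (Block v)} {S : Finset (ZMod v)} {y : ZMod v} :
    y ∈ fixedHull B S ↔ ∀ f ∈ automorphisms B, (∀ s ∈ S, f s = s) → f y = y := by
  simp [fixedHull]

theorem isSubsystem_fixedHull {v : ℕ} [NeZero v] {B : Set (Block v)} (hB : IsDesign v 5 B)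
    (S : Finset (ZMod v)) : IsSubsystem B (fixedHull B S) := by
  intro c hc h0 h1 j
  rw [mem_fixedHull] at h0 h1 ⊢
  intro f hf hS
  have hfc : Traverses B (f ∘ c) :=
    ⟨f.injective.comp hc.1, by rw [← image_edgesOf]; exact (hf _).2 hc.2⟩
  exact congrFun (hfc.eq_of_eq hB hc (i := 0) (h0 f hf hS) (h1 f hf hS)) j

theorem exists_fixedHull_large {v : ℕ} [NeZero v] {B : Set (Block v)} (hB : IsDesign v 5 B)
    (k : ℕ) : ∃ S : Finset (ZMod v), S.card ≤ k + 1 ∧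
      (fixedHull B S = Finset.univ ∨ 3 ^ k ≤ 2 ^ k * (fixedHull B S).card) := by
  classical
  induction k with
  | zero =>
    refine ⟨{0}, by simp, Or.inr ?_⟩
    have : (0 : ZMod v) ∈ fixedHull B {0} := mem_fixedHull.2 (by simp)
    simpa using Finset.card_pos.2 ⟨_, this⟩
  | succ k ih =>
    obtain ⟨S, hS, h⟩ := ih
    by_cases hu : fixedHull B S = Finset.univ
    · exact ⟨S, by omega, Or.inl hu⟩
    replace h := h.resolve_left hu
    obtain ⟨x, hx⟩ : ∃ x, x ∉ fixedHull B S := by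
      by_contra! hh
      exact hu (Finset.eq_univ_iff_forall.2 hh)
    refine ⟨insert x S, (Finset.card_insert_le _ _).trans (by omega), Or.inr ?_⟩
    have hsub : fixedHull B S ⊂ fixedHull B (insert x S) := by
      refine Finset.ssubset_iff_of_subset (fun y hy => ?_) |>.2 ⟨x, ?_, hx⟩
      · rw [mem_fixedHull] at hy ⊢
        exact fun f hf hs => hy f hf fun s hs' => hs s (Finset.mem_insert_of_mem hs')
      · exact mem_fixedHull.2 fun f _ hs => hs x (Finset.mem_insert_self _ _)
    have := (isSubsystem_fixedHull hB S).card_le hB (isSubsystem_fixedHull hB _) hsub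
    rw [pow_succ, pow_succ]
    calc 3 ^ k * 3 ≤ (2 ^ k * (fixedHull B S).card) * 3 := Nat.mul_le_mul_right _ h
      _ = 2 ^ k * (3 * (fixedHull B S).card) := by ring
      _ ≤ 2 ^ k * (2 * (fixedHull B (insert x S)).card) := Nat.mul_le_mul_left _ this
      _ = _ := by ring

/-- A `C₅`-design of order `v` has at most `v ^ O(log v)` automorphisms. -/
theorem card_automorphisms_le {v : ℕ} [NeZero v] {B : Set (Block v)} (hB : IsDesign v 5 B)
    {k : ℕ} (hk : 2 ^ k * v < 3 ^ k) : Nat.card (automorphisms B) ≤ v ^ (k + 1) := by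
  obtain ⟨S, hS, h⟩ := exists_fixedHull_large hB k
  have hu : fixedHull B S = Finset.univ := by
    refine h.resolve_right fun hh => ?_
    have h1 : (fixedHull B S).card ≤ v := by
      simpa [ZMod.card] using Finset.card_le_univ (fixedHull B S)
    exact absurd (hh.trans (Nat.mul_le_mul_left _ h1)) (by omega)
  have hinj : Function.Injective
      (fun (f : automorphisms B) (s : S) => (f : Equiv.Perm (ZMod v)) s) := by
    intro f g hfg
    have hmem := (f⁻¹ * g).2
    refine Subtype.ext (Equiv.ext fun y => ?_)
    have hy : y ∈ fixedHull B S := hu ▸ Finset.mem_univ y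
    have := mem_fixedHull.1 hy _ hmem fun s hs => by
      have := congrFun hfg ⟨s, hs⟩
      simp only at this
      simp [Equiv.symm_apply_eq, this]
    simp only [Subgroup.coe_mul, Subgroup.coe_inv, Equiv.Perm.coe_mul, Function.comp_apply,
      Equiv.Perm.inv_eq_iff_eq] at this
    exact this.symm
  calc Nat.card (automorphisms B) ≤ Nat.card (S → ZMod v) :=
        Nat.card_le_card_of_injective _ hinj
    _ = v ^ S.card := by simp
    _ ≤ v ^ (k + 1) := Nat.pow_le_pow_right (Nat.pos_of_ne_zero (NeZero.ne v)) hS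

/-! ### Isomorphism classes of cyclic designs -/

theorem mem_image_mapBlock_iff {v : ℕ} {B B' : Set (Block v)} {f : Equiv.Perm (ZMod v)}
    (h : B' = (fun E : Block v => E.image (Sym2.map f)) '' B) (E : Block v) :
    E ∈ B' ↔ mapBlock f⁻¹ E ∈ B := by
  subst h
  constructor
  · rintro ⟨F, hF, rfl⟩
    change mapBlock f⁻¹ (mapBlock f F) ∈ B
    rwa [← mapBlock_mul, inv_mul_cancel, mapBlock_one]
  · intro hE
    refine ⟨_, hE, ?_⟩
    change mapBlock f (mapBlock f⁻¹ E) = E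
    rw [← mapBlock_mul, mul_inv_cancel, mapBlock_one]

theorem eq_image_mapBlock {v : ℕ} {B B' : Set (Block v)} {f : Equiv.Perm (ZMod v)}
    (h : ∀ E, E ∈ B' ↔ mapBlock f⁻¹ E ∈ B) :
    B' = (fun E : Block v => E.image (Sym2.map f)) '' B := by
  ext E
  rw [h E, mem_image_mapBlock_iff rfl]

theorem isomorphic_equivalence (v : ℕ) : Equivalence (Isomorphic (v := v)) where
  refl B := ⟨1, eq_image_mapBlock fun E => by rw [inv_one, mapBlock_one]⟩
  symm := by
    rintro B B' ⟨f, hf⟩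
    refine ⟨f⁻¹, eq_image_mapBlock fun E => ?_⟩
    rw [mem_image_mapBlock_iff hf, ← mapBlock_mul, inv_inv, inv_mul_cancel, mapBlock_one]
  trans := by
    rintro B B' B'' ⟨f, hf⟩ ⟨g, hg⟩
    refine ⟨(g * f : Equiv.Perm (ZMod v)), eq_image_mapBlock fun E => ?_⟩
    rw [mem_image_mapBlock_iff hg, mem_image_mapBlock_iff hf, ← mapBlock_mul, mul_inv_rev]

theorem IsCyclicDesign.addRight_mem {v : ℕ} {B : Set (Block v)} (hB : IsCyclicDesign v 5 B)
    (z : ZMod v) : (Equiv.addRight z : Equiv.Perm (ZMod v)) ∈ automorphisms B := by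
  have h : ∀ z E, E ∈ B → mapBlock (Equiv.addRight z) E ∈ B := fun z E hE => hB.2 E hE z
  refine fun E => ⟨fun hE => ?_, h z E⟩
  have := h (-z) _ hE
  rwa [← mapBlock_mul, show (Equiv.addRight (-z) * Equiv.addRight z : Equiv.Perm (ZMod v)) = 1
    from Equiv.ext fun x => by simp, mapBlock_one] at this

theorem eq_addRight_of_commute {v : ℕ} [NeZero v] {g : Equiv.Perm (ZMod v)}
    (h : g * Equiv.addRight 1 = Equiv.addRight 1 * g) : g = Equiv.addRight (g 0) := by
  have h1 : ∀ y, g (y + 1) = g y + 1 := fun y => by simpa using Equiv.congr_fun h y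
  have h2 : ∀ k : ℕ, g k = k + g 0 := by
    intro k
    induction k with
    | zero => simp
    | succ k ih => rw [Nat.cast_succ, h1, ih]; ring
  ext y : 1
  simpa using h2 y.val

/-- The cyclic designs isomorphic to `B` are at most as many as the automorphisms of `B`, since
such a design is determined by the pull-back of the translation by `1`. -/
theorem card_isomorphic_le {v : ℕ} [NeZero v] (B : Set (Block v)) :
    Nat.card {B' : {B' : Set (Block v) // IsCyclicDesign v 5 B'} // Isomorphic B B'.1} ≤
      Nat.card (automorphisms B) := by
  choose f hf using fun B' : {B' : {B' : Set (Block v) // IsCyclicDesign v 5 B'} //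
    Isomorphic B B'.1} => B'.2
  replace hf := fun B' => mem_image_mapBlock_iff (f := f B') (hf B')
  have hmem : ∀ B', ((f B')⁻¹ * Equiv.addRight 1 * f B' : Equiv.Perm (ZMod v)) ∈
      automorphisms B := by
    intro B' E
    rw [mul_assoc, mapBlock_mul, ← hf, mapBlock_mul, B'.1.2.addRight_mem 1, hf, ← mapBlock_mul,
      inv_mul_cancel, mapBlock_one]
  refine Nat.card_le_card_of_injective (fun B' => ⟨_, hmem B'⟩) ?_
  intro B₁ B₂ h
  have h' : (f B₁)⁻¹ * Equiv.addRight 1 * f B₁ = (f B₂)⁻¹ * Equiv.addRight 1 * f B₂ :=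
    congrArg Subtype.val h
  have hg := eq_addRight_of_commute (g := f B₂ * (f B₁)⁻¹) (by
    calc f B₂ * (f B₁)⁻¹ * Equiv.addRight 1
        = f B₂ * ((f B₁)⁻¹ * Equiv.addRight 1 * f B₁) * (f B₁)⁻¹ := by group
      _ = f B₂ * ((f B₂)⁻¹ * Equiv.addRight 1 * f B₂) * (f B₁)⁻¹ := by rw [h']
      _ = _ := by group)
  refine Subtype.ext (Subtype.ext (Set.ext fun E => ?_))
  have hmem := (automorphisms B₁.1.1).inv_mem
    (B₁.1.2.addRight_mem ((f B₂ * (f B₁)⁻¹) 0))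
  rw [← hg] at hmem
  rw [hf B₂, ← hmem E, hf B₁, ← mapBlock_mul]
  congr! 2
  group

theorem card_cyclicDesign_le {v : ℕ} [NeZero v] {k : ℕ} (hk : 2 ^ k * v < 3 ^ k) :
    Nat.card {B : Set (Block v) // IsCyclicDesign v 5 B} ≤ NC v 5 * v ^ (k + 1) := by
  classical
  let r : {B : Set (Block v) // IsCyclicDesign v 5 B} →
    {B : Set (Block v) // IsCyclicDesign v 5 B} → Prop := fun B B' => Isomorphic B.1 B'.1
  have hr : Equivalence r := (isomorphic_equivalence v).comap Subtype.val
  have : Fintype (Quot r) := Fintype.ofFinite _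
  rw [← Nat.card_congr (Equiv.sigmaFiberEquiv (Quot.mk r)), Nat.card_sigma]
  calc _ ≤ ∑ _q : Quot r, v ^ (k + 1) := ?_
    _ = NC v 5 * v ^ (k + 1) := by
      rw [Finset.sum_const, Finset.card_univ, smul_eq_mul, NC, Nat.card_eq_fintype_card]
  refine Finset.sum_le_sum fun q _ => ?_
  obtain ⟨B, rfl⟩ := Quot.exists_rep q
  refine le_trans (le_trans (Nat.card_congr (Equiv.subtypeEquivRight fun B' => ?_)).le
    (card_isomorphic_le B.1)) (card_automorphisms_le B.2.1 hk)
  exact ⟨fun h => hr.quot_mk_eq_iff _ _ |>.1 h.symm, fun h => (Quot.sound (r := r) h).symm⟩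

/-! ### Difference families and their developments -/

/-- Rows of five differences with zero sum, covering each nonzero element exactly once up to
sign. -/
structure IsDifferenceFamily {v : ℕ} {ι : Type*} (a : ι → Fin 5 → ZMod v) : Prop where
  sum_eq_zero : ∀ i, ∑ j, a i j = 0
  covers : ∀ z, z ≠ 0 → ∃ i j, z = a i j ∨ z = -a i j
  injective : ∀ i j i' j', a i j = a i' j' → i = i' ∧ j = j'
  ne_neg : ∀ i j i' j', a i j ≠ -a i' j'

theorem IsDifferenceFamily.ne_zero {v : ℕ} {ι : Type*} {a : ι → Fin 5 → ZMod v}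
    (h : IsDifferenceFamily a) (i : ι) (j : Fin 5) : a i j ≠ 0 := fun h0 =>
  h.ne_neg i j i j (by rw [h0, neg_zero])

/-- Covering suffices when the number of rows is right. -/
theorem IsDifferenceFamily.of_covers {v : ℕ} [NeZero v] {ι : Type*} [Fintype ι]
    {a : ι → Fin 5 → ZMod v} (hcard : 10 * Fintype.card ι + 1 = v)
    (hsum : ∀ i, ∑ j, a i j = 0) (hcov : ∀ z, z ≠ 0 → ∃ i j, z = a i j ∨ z = -a i j) :
    IsDifferenceFamily a := by
  classical
  let φ : ι × Fin 5 × Bool → ZMod v := fun p => if p.2.2 then a p.1 p.2.1 else -a p.1 p.2.1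
  have hsub : (Finset.univ.erase (0 : ZMod v)) ⊆ Finset.univ.image φ := by
    intro z hz
    obtain ⟨i, j, h | h⟩ := hcov z (Finset.ne_of_mem_erase hz)
    · exact Finset.mem_image.2 ⟨(i, j, true), Finset.mem_univ _, by simp [φ, h]⟩
    · exact Finset.mem_image.2 ⟨(i, j, false), Finset.mem_univ _, by simp [φ, h]⟩
  have h1 : (Finset.univ.image φ).card = (Finset.univ : Finset (ι × Fin 5 × Bool)).card := by
    refine le_antisymm Finset.card_image_le ?_
    have := Finset.card_le_card hsub
    rw [Finset.card_erase_of_mem (Finset.mem_univ _), Finset.card_univ, ZMod.card] at this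
    rw [Finset.card_univ, Fintype.card_prod, Fintype.card_prod, Fintype.card_fin,
      Fintype.card_bool]
    omega
  have hinj : Function.Injective φ := by
    have := Finset.card_image_iff.1 h1
    rwa [Finset.coe_univ, Set.injOn_univ] at this
  refine ⟨hsum, hcov, fun i j i' j' h => ?_, fun i j i' j' h => ?_⟩
  · have := @hinj (i, j, true) (i', j', true) (by simp [φ, h])
    simpa using this
  · have := @hinj (i, j, true) (i', j', false) (by simp [φ, h])
    simp at this

/-- The closed walk through `0` with the given successive differences. -/
def walk {v : ℕ} (d : Fin 5 → ZMod v) : Fin 5 → ZMod v :=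
  ![0, d 0, d 0 + d 1, d 0 + d 1 + d 2, d 0 + d 1 + d 2 + d 3]

theorem walk_add_one {v : ℕ} {d : Fin 5 → ZMod v} (h : ∑ j, d j = 0) (j : Fin 5) :
    walk d (j + 1) = walk d j + d j := by
  rw [Fin.sum_univ_five] at h
  fin_cases j <;> simp [walk, h]

theorem walk_injective {v : ℕ} {ι : Type*} {a : ι → Fin 5 → ZMod v}
    (h : IsDifferenceFamily a) (i : ι) : Function.Injective (walk (a i)) := by
  have h0 := h.ne_zero i
  have h2 : ∀ j k, a i j + a i k ≠ 0 := fun j k hh =>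
    h.ne_neg i j i k (eq_neg_of_add_eq_zero_left hh)
  have hs := h.sum_eq_zero i
  rw [Fin.sum_univ_five] at hs
  have key : ∀ j k : Fin 5, j < k → walk (a i) j ≠ walk (a i) k := by
    intro j k hjk hh
    fin_cases j <;> fin_cases k <;> simp [walk] at hjk hh
    · exact h0 0 hh.symm
    · exact h2 0 1 hh.symm
    · exact h2 3 4 (by linear_combination hs + hh)
    · exact h0 4 (by linear_combination hs + hh)
    · exact h0 1 hh
    · exact h2 1 2 (by linear_combination -hh)
    · exact h2 0 4 (by linear_combination hs + hh)
    · exact h0 2 hh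
    · exact h2 2 3 (by linear_combination -hh)
    · exact h0 3 hh
  intro j k hjk
  rcases lt_trichotomy j k with hlt | heq | hlt
  · exact absurd hjk (key _ _ hlt)
  · exact heq
  · exact absurd hjk.symm (key _ _ hlt)

/-- All translates of the cycles given by the rows of `a`. -/
def development {v : ℕ} {ι : Type*} (a : ι → Fin 5 → ZMod v) : Set (Block v) :=
  {E | ∃ i z, E = translateBlock (edgesOf (walk (a i))) z}

theorem translateBlock_edgesOf {v : ℕ} (c : Fin 5 → ZMod v) (z : ZMod v) :
    translateBlock (edgesOf c) z = edgesOf (fun j => c j + z) :=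
  image_edgesOf c (· + z)

theorem mem_translateBlock_walk {v : ℕ} {d : Fin 5 → ZMod v} (h : ∑ j, d j = 0) {z : ZMod v}
    {e : Sym2 (ZMod v)} : e ∈ translateBlock (edgesOf (walk d)) z ↔
      ∃ j, e = s(walk d j + z, walk d j + d j + z) := by
  rw [translateBlock_edgesOf, mem_edgesOf]
  simp only [walk_add_one h]

/-- The rows of `a` can be recovered from the differences of the edges of a block. -/
theorem exists_of_mem_translateBlock {v : ℕ} {d : Fin 5 → ZMod v} (h : ∑ j, d j = 0)
    {x y z : ZMod v} (he : s(x, y) ∈ translateBlock (edgesOf (walk d)) z) :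
    ∃ j, (y - x = d j ∧ z = x - walk d j) ∨ (y - x = -d j ∧ z = y - walk d j) := by
  obtain ⟨j, hj⟩ := (mem_translateBlock_walk h).1 he
  refine ⟨j, ?_⟩
  rcases Sym2.eq_iff.1 hj with ⟨rfl, rfl⟩ | ⟨rfl, rfl⟩
  · left; constructor <;> ring
  · right; constructor <;> ring

theorem IsDifferenceFamily.isCyclicDesign {v : ℕ} {ι : Type*} {a : ι → Fin 5 → ZMod v}
    (h : IsDifferenceFamily a) : IsCyclicDesign v 5 (development a) := by
  refine ⟨⟨?_, ?_⟩, ?_⟩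
  · rintro E ⟨i, z, rfl⟩
    exact ⟨_, (add_left_injective z).comp (walk_injective h i), translateBlock_edgesOf _ _⟩
  · intro e
    induction e with | _ x y
    intro hxy
    replace hxy : y - x ≠ 0 := fun hh => hxy (by simpa using (sub_eq_zero.1 hh).symm)
    refine existsUnique_of_exists_of_unique ?_ ?_
    · obtain ⟨i, j, hij | hij⟩ := h.covers _ hxy
      · refine ⟨_, ⟨i, x - walk (a i) j, rfl⟩,
          (mem_translateBlock_walk (h.sum_eq_zero i)).2 ⟨j, ?_⟩⟩
        rw [← hij]
        congr 2 <;> ring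
      · refine ⟨_, ⟨i, y - walk (a i) j, rfl⟩,
          (mem_translateBlock_walk (h.sum_eq_zero i)).2 ⟨j, ?_⟩⟩
        rw [← neg_eq_iff_eq_neg.2 hij, Sym2.eq_swap]
        congr 2 <;> ring
    · rintro _ _ ⟨⟨i, z, rfl⟩, he⟩ ⟨⟨i', z', rfl⟩, he'⟩
      obtain ⟨j, hj⟩ := exists_of_mem_translateBlock (h.sum_eq_zero i) he
      obtain ⟨j', hj'⟩ := exists_of_mem_translateBlock (h.sum_eq_zero i') he'
      rcases hj with ⟨h1, h2⟩ | ⟨h1, h2⟩ <;> rcases hj' with ⟨h1', h2'⟩ | ⟨h1', h2'⟩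
      · obtain ⟨rfl, rfl⟩ := h.injective _ _ _ _ (h1.symm.trans h1')
        rw [h2, h2']
      · exact absurd (h1.symm.trans h1') (h.ne_neg _ _ _ _)
      · exact absurd (h1'.symm.trans h1) (h.ne_neg _ _ _ _)
      · obtain ⟨rfl, rfl⟩ := h.injective _ _ _ _ (neg_injective (h1.symm.trans h1'))
        rw [h2, h2']
  · rintro _ ⟨i, z, rfl⟩ w
    refine ⟨i, z + w, ?_⟩
    rw [translateBlock_edgesOf, translateBlock_edgesOf, translateBlock_edgesOf]
    simp only [add_assoc]

/-- Permute the last two differences among the rows other than `none`. -/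
def exchange {v : ℕ} {κ : Type*} (a : Option κ → Fin 5 → ZMod v) (σ : Equiv.Perm κ) :
    Option κ → Fin 5 → ZMod v :=
  fun i j => a ((if j < 3 then 1 else σ.optionCongr : Equiv.Perm (Option κ)) i) j

theorem isDifferenceFamily_exchange {v : ℕ} {κ : Type*} {a : Option κ → Fin 5 → ZMod v}
    (h : IsDifferenceFamily a) {s : ZMod v} (hs : ∀ i, a (some i) 3 + a (some i) 4 = s)
    (σ : Equiv.Perm κ) : IsDifferenceFamily (exchange a σ) := by
  refine ⟨?_, ?_, ?_, ?_⟩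
  · rintro (_ | i)
    · have h1 := h.sum_eq_zero none
      rw [Fin.sum_univ_five] at h1 ⊢
      simpa [exchange] using h1
    · have h1 := h.sum_eq_zero (some i)
      rw [Fin.sum_univ_five, add_assoc, hs, ← hs (σ i), ← add_assoc] at h1
      rw [Fin.sum_univ_five]
      simpa [exchange] using h1
  · intro z hz
    obtain ⟨i, j, hij⟩ := h.covers z hz
    exact ⟨(if j < 3 then 1 else σ.optionCongr : Equiv.Perm (Option κ)).symm i, j, by
      simpa only [exchange, Equiv.apply_symm_apply] using hij⟩
  · intro i j i' j' hh
    obtain ⟨hi, rfl⟩ := h.injective _ _ _ _ hh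
    exact ⟨Equiv.injective _ hi, rfl⟩
  · exact fun i j i' j' => h.ne_neg _ _ _ _

theorem exists_row_of_development_eq {v : ℕ} {ι : Type*} {a b : ι → Fin 5 → ZMod v}
    (ha : IsDifferenceFamily a) (hb : IsDifferenceFamily b)
    (h : development a = development b) (i : ι) :
    ∃ i', ∀ j, ∃ j', a i j = b i' j' ∨ a i j = -b i' j' := by
  have hE : translateBlock (edgesOf (walk (a i))) 0 ∈ development b := h ▸ ⟨i, 0, rfl⟩
  obtain ⟨i', z, hi'⟩ := hE
  refine ⟨i', fun j => ?_⟩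
  have hm := (mem_translateBlock_walk (z := 0) (ha.sum_eq_zero i)).2 ⟨j, rfl⟩
  rw [hi'] at hm
  obtain ⟨j', hj'⟩ := exists_of_mem_translateBlock (hb.sum_eq_zero i') hm
  rw [show walk (a i) j + a i j + 0 - (walk (a i) j + 0) = a i j by ring] at hj'
  exact ⟨j', hj'.imp And.left And.left⟩

theorem development_exchange_injective {v : ℕ} {κ : Type*} {a : Option κ → Fin 5 → ZMod v}
    (h : IsDifferenceFamily a) {s : ZMod v} (hs : ∀ i, a (some i) 3 + a (some i) 4 = s) :
    Function.Injective fun σ : Equiv.Perm κ => development (exchange a σ) := by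
  intro σ τ hst
  ext i
  obtain ⟨i', hi'⟩ := exists_row_of_development_eq (isDifferenceFamily_exchange h hs σ)
    (isDifferenceFamily_exchange h hs τ) hst (some i)
  have key : ∀ j : Fin 5,
      (if j < 3 then 1 else σ.optionCongr : Equiv.Perm (Option κ)) (some i) =
        (if j < 3 then 1 else τ.optionCongr : Equiv.Perm (Option κ)) i' := by
    intro j
    obtain ⟨j', hj | hj⟩ := hi' j
    · obtain ⟨hr, rfl⟩ := h.injective _ _ _ _ hj
      exact hr
    · exact absurd hj (h.ne_neg _ _ _ _)
  have h0 : some i = i' := by simpa using key 0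
  subst h0
  simpa using key 3

theorem factorial_le_card_cyclicDesign {v k : ℕ} [NeZero v] {a : Option (Fin k) → Fin 5 → ZMod v}
    (h : IsDifferenceFamily a) {s : ZMod v} (hs : ∀ i, a (some i) 3 + a (some i) 4 = s) :
    k.factorial ≤ Nat.card {B : Set (Block v) // IsCyclicDesign v 5 B} := by
  classical
  have := Nat.card_le_card_of_injective
    (fun σ : Equiv.Perm (Fin k) => (⟨development (exchange a σ),
      (isDifferenceFamily_exchange h hs σ).isCyclicDesign⟩ :
        {B : Set (Block v) // IsCyclicDesign v 5 B}))
    fun σ τ hst => development_exchange_injective h hs (congrArg Subtype.val hst)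
  rwa [Nat.card_eq_fintype_card, Fintype.card_perm, Fintype.card_fin] at this

/-! ### A difference family with many interchangeable pairs -/

/-- The larger of the two numbers at distance `i + 2` in row `i`: for even `i` they are centred at
`p`, for odd `i` at `p + n + 1 / 2`. -/
def upper (n p i : ℕ) : ℕ :=
  if i % 2 = 0 then p + (i / 2 + 1) else p + n + 1 + (i / 2 + 1)

/-- The smaller of the two numbers at distance `i + 2` in row `i`. -/
def lower (n p i : ℕ) : ℕ :=
  if i % 2 = 0 then p - (i / 2 + 1) else p + n - (i / 2 + 1)

/-- The smaller of the two consecutive numbers in row `i`. -/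
def pairStart (n p i : ℕ) : ℕ :=
  if i = 0 then p + n
  else if i ≤ (p - n / 2 - n - 2) / 2 then n + 2 * i
  else p + n + (n - 1) / 2 + 2 + 2 * (i - (p - n / 2 - n - 2) / 2 - 1)

theorem exists_eq_of_le {n p y : ℕ} (hn : 20 ≤ n) (hp : 2 * n ≤ p) (hp' : p ≤ 2 * n + 3)
    (hpar : (p - n / 2 - n) % 2 = 0) (hy : 1 ≤ y) (hy' : y ≤ 5 * n) :
    (y = p ∨ y = n ∨ y = n + 1 ∨ y = 5 * n ∨ y = 5 * n - 1) ∨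
      ∃ i < n - 1, y = i + 1 ∨ y = upper n p i ∨ y = lower n p i ∨ y = pairStart n p i ∨
        y = pairStart n p i + 1 := by
  by_cases hx : y < n
  · exact Or.inr ⟨y - 1, by omega, by omega⟩
  by_cases hgap : n + 2 ≤ y ∧ y < p - n / 2
  · refine Or.inr ⟨(y - n) / 2, by omega, ?_⟩
    have : pairStart n p ((y - n) / 2) = n + 2 * ((y - n) / 2) := by
      rw [pairStart, if_neg (by omega), if_pos (by omega)]
    omega
  by_cases hl : p - n / 2 ≤ y ∧ y < p
  · refine Or.inr ⟨2 * (p - y - 1), by omega, ?_⟩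
    have : lower n p (2 * (p - y - 1)) = y := by
      rw [lower, if_pos (by omega)]; omega
    omega
  by_cases hu : p < y ∧ y ≤ p + n / 2
  · refine Or.inr ⟨2 * (y - p - 1), by omega, ?_⟩
    have : upper n p (2 * (y - p - 1)) = y := by
      rw [upper, if_pos (by omega)]; omega
    omega
  by_cases hl' : p + n / 2 < y ∧ y < p + n
  · refine Or.inr ⟨2 * (p + n - y) - 1, by omega, ?_⟩
    have : lower n p (2 * (p + n - y) - 1) = y := by
      rw [lower, if_neg (by omega)]; omega
    omega
  by_cases hc : p + n ≤ y ∧ y ≤ p + n + 1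
  · refine Or.inr ⟨0, by omega, ?_⟩
    have : pairStart n p 0 = p + n := if_pos rfl
    omega
  by_cases hu' : p + n + 1 < y ∧ y ≤ p + n + 1 + (n - 1) / 2
  · refine Or.inr ⟨2 * (y - p - n - 1) - 1, by omega, ?_⟩
    have : upper n p (2 * (y - p - n - 1) - 1) = y := by
      rw [upper, if_neg (by omega)]; omega
    omega
  by_cases htop : p + n + 1 + (n - 1) / 2 < y ∧ y < 5 * n - 1
  · obtain ⟨w, hw⟩ : ∃ w, w = (y - (p + n + (n - 1) / 2 + 2)) / 2 := ⟨_, rfl⟩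
    refine Or.inr ⟨(p - n / 2 - n - 2) / 2 + 1 + w, by omega, ?_⟩
    have : pairStart n p ((p - n / 2 - n - 2) / 2 + 1 + w) =
        p + n + (n - 1) / 2 + 2 + 2 * w := by
      rw [pairStart, if_neg (by omega), if_neg (by omega)]; omega
    omega
  omega

/-- The rows of the difference family. -/
def rows (n p : ℕ) (e : ℤ) : Option (Fin (n - 1)) → Fin 5 → ℤ
  | none => ![p, -n, -(n + 1), 5 * n, e]
  | some i => ![-(i + 1), upper n p i, -lower n p i, pairStart n p i, -(pairStart n p i + 1)]

theorem isDifferenceFamily_rows {n p : ℕ} {e : ℤ} (hn : 20 ≤ n)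
    (hpar : (p - n / 2 - n) % 2 = 0)
    (h : p = 2 * n ∧ e = -(5 * n - 1) ∨ p = 2 * n + 3 ∧ e = 5 * n - 1) :
    IsDifferenceFamily fun i j => (rows n p e i j : ZMod (10 * n + 1)) := by
  have hv : (10 * n + 1 : ZMod (10 * n + 1)) = 0 := by
    exact_mod_cast ZMod.natCast_self (10 * n + 1)
  refine .of_covers ?_ ?_ ?_
  · rw [Fintype.card_option, Fintype.card_fin]; omega
  · rintro (_ | i)
    · rw [Fin.sum_univ_five]
      rcases h with ⟨rfl, rfl⟩ | ⟨rfl, rfl⟩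
      · simp [rows]; ring
      · simp [rows]; linear_combination hv
    · have hi := i.2
      have : (upper n p i : ℤ) - lower n p i = i + 2 := by
        simp only [upper, lower]
        split_ifs <;> omega
      rw [Fin.sum_univ_five, ← Int.cast_add, ← Int.cast_add, ← Int.cast_add, ← Int.cast_add]
      convert Int.cast_zero
      simp [rows]
      linarith
  · intro z hz
    have hle := ZMod.natAbs_valMinAbs_le z
    have hpos : 1 ≤ z.valMinAbs.natAbs := by
      rw [Nat.one_le_iff_ne_zero, Ne, Int.natAbs_eq_zero, ZMod.valMinAbs_eq_zero]
      exact hz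
    suffices hs : ∃ i j, z.valMinAbs = rows n p e i j ∨ z.valMinAbs = -rows n p e i j by
      obtain ⟨i, j, hij⟩ := hs
      rw [← ZMod.coe_valMinAbs z]
      refine ⟨i, j, hij.imp (fun h => by rw [h]) fun h => by rw [h, Int.cast_neg]⟩
    rcases exists_eq_of_le (y := z.valMinAbs.natAbs) (p := p) hn (by omega) (by omega) hpar hpos
      (by omega) with (hy | hy | hy | hy | hy) | ⟨i, hi, hy | hy | hy | hy | hy⟩
    · exact ⟨none, 0, by simp only [rows]; simp; omega⟩
    · exact ⟨none, 1, by simp only [rows]; simp; omega⟩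
    · exact ⟨none, 2, by simp only [rows]; simp; omega⟩
    · exact ⟨none, 3, by simp only [rows]; simp; omega⟩
    · exact ⟨none, 4, by simp only [rows]; simp; omega⟩
    · exact ⟨some ⟨i, hi⟩, 0, by simp only [rows]; simp; omega⟩
    · exact ⟨some ⟨i, hi⟩, 1, by simp only [rows]; simp; omega⟩
    · exact ⟨some ⟨i, hi⟩, 2, by simp only [rows]; simp; omega⟩
    · exact ⟨some ⟨i, hi⟩, 3, by simp only [rows]; simp; omega⟩
    · exact ⟨some ⟨i, hi⟩, 4, by simp only [rows]; simp; omega⟩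

theorem factorial_pred_le_card_cyclicDesign {n : ℕ} (hn : 20 ≤ n) :
    (n - 1).factorial ≤
      Nat.card {B : Set (Block (10 * n + 1)) // IsCyclicDesign (10 * n + 1) 5 B} := by
  obtain ⟨p, e, hpar, h⟩ : ∃ (p : ℕ) (e : ℤ), (p - n / 2 - n) % 2 = 0 ∧
      (p = 2 * n ∧ e = -(5 * n - 1) ∨ p = 2 * n + 3 ∧ e = 5 * n - 1) := by
    by_cases h : (2 * n - n / 2 - n) % 2 = 0
    · exact ⟨_, _, h, Or.inl ⟨rfl, rfl⟩⟩
    · exact ⟨_, _, by omega, Or.inr ⟨rfl, rfl⟩⟩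
  refine factorial_le_card_cyclicDesign (isDifferenceFamily_rows hn hpar h) (s := -1) fun i => ?_
  simp [rows]

/-! ### Growth -/

theorem eventually_pow_le_factorial :
    ∃ N : ℕ, ∀ n ≥ N, (38.4 : ℝ) ^ n * 2 ^ n ≤ ((n - 1).factorial : ℝ) := by
  have h := (FloorSemiring.tendsto_pow_div_factorial_atTop (154 : ℝ)).eventually
    (eventually_le_nhds (by norm_num : (0 : ℝ) < 1))
  obtain ⟨N, hN⟩ := Filter.eventually_atTop.1 h
  refine ⟨max N 1, fun n hn => ?_⟩
  have h1 := hN n (le_trans (le_max_left _ _) hn)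
  have hn1 : 1 ≤ n := le_trans (le_max_right _ _) hn
  rw [div_le_one (by positivity)] at h1
  have h2 : (n.factorial : ℝ) = n * ((n - 1).factorial : ℝ) := by
    exact_mod_cast (Nat.mul_factorial_pred (by omega)).symm
  have h3 : (n : ℝ) ≤ 2 ^ n := by exact_mod_cast Nat.lt_two_pow_self.le
  have h4 : (0 : ℝ) < n := by exact_mod_cast hn1
  refine le_of_mul_le_mul_left ?_ h4
  calc (n : ℝ) * (38.4 ^ n * 2 ^ n) ≤ 2 ^ n * (38.4 ^ n * 2 ^ n) := by gcongr
    _ = (2 * (38.4 * 2)) ^ n := by rw [mul_pow, mul_pow]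
    _ ≤ 154 ^ n := by gcongr; norm_num
    _ ≤ _ := h1.trans h2.le

theorem quadratic_le_two_pow {l : ℕ} (hl : 14 ≤ l) :
    20 * (l + 1) ^ 2 + 10 * (l + 1) + 1 ≤ 2 ^ l := by
  induction l, hl using Nat.le_induction with
  | base => norm_num
  | succ l hl ih => rw [pow_succ 2]; nlinarith

/-- Quasi-polynomial factors are eventually at most `2 ^ n`. -/
theorem exists_exponent {n : ℕ} (hn : 2 ^ 14 ≤ n) :
    ∃ k : ℕ, 2 ^ k * (10 * n + 1) < 3 ^ k ∧ (10 * n + 1) ^ (k + 1) ≤ 2 ^ n := by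
  set l := Nat.log 2 (10 * n + 1) with hl
  have h1 : 2 ^ l ≤ 10 * n + 1 := Nat.pow_log_le_self 2 (by omega)
  have h2 : 10 * n + 1 < 2 ^ (l + 1) := Nat.lt_pow_succ_log_self (by norm_num) _
  have h3 : 14 ≤ l := by
    rw [hl]
    exact (Nat.le_log_iff_pow_le (by norm_num) (by omega)).2 (by omega)
  have h4 := quadratic_le_two_pow h3
  refine ⟨2 * (l + 1), ?_, ?_⟩
  · calc 2 ^ (2 * (l + 1)) * (10 * n + 1) < 2 ^ (2 * (l + 1)) * 2 ^ (l + 1) := by gcongr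
      _ = 8 ^ (l + 1) := by rw [pow_mul, ← mul_pow]; norm_num
      _ ≤ 9 ^ (l + 1) := by gcongr; norm_num
      _ = 3 ^ (2 * (l + 1)) := by rw [pow_mul]; norm_num
  · calc (10 * n + 1) ^ (2 * (l + 1) + 1) ≤ (2 ^ (l + 1)) ^ (2 * (l + 1) + 1) := by gcongr
      _ = 2 ^ ((l + 1) * (2 * (l + 1) + 1)) := by rw [pow_mul]
      _ ≤ 2 ^ n := by
        gcongr
        · norm_num
        · nlinarith

end CCS

/-- For all sufficiently large `n ≡ 4 (mod 7)`,
`NC(10n+1, 5) ≥ 38.4^n`. -/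
theorem stmt10 : ∃ N : ℕ, ∀ n : ℕ, N ≤ n → n % 7 = 4 →
    (38.4 : ℝ) ^ n ≤ (CCS.NC (10 * n + 1) 5 : ℝ) := by
  obtain ⟨N, hN⟩ := CCS.eventually_pow_le_factorial
  refine ⟨max N (2 ^ 14), fun n hn _ => ?_⟩
  have hn' : 2 ^ 14 ≤ n := le_trans (le_max_right _ _) hn
  obtain ⟨k, hk, hk'⟩ := CCS.exists_exponent hn'
  have h1 : (n - 1).factorial ≤ CCS.NC (10 * n + 1) 5 * 2 ^ n :=
    calc (n - 1).factorial ≤ _ := CCS.factorial_pred_le_card_cyclicDesign (by omega)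
      _ ≤ _ := CCS.card_cyclicDesign_le hk
      _ ≤ _ := Nat.mul_le_mul_left _ hk'
  have h2 : ((n - 1).factorial : ℝ) ≤ CCS.NC (10 * n + 1) 5 * 2 ^ n := by exact_mod_cast h1
  exact le_of_mul_le_mul_right ((hN n (le_trans (le_max_left _ _) hn)).trans h2) (by positivity)
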